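/- Let I and J be nonempty finite index sets and let a, b : I × J → ℝ with a_{ij} > 0 and b_{ij} > 0 for all i, j. Define the posterior weights w_{ij} = a_{ij} / Σ_k a_{ik}. If Σ_i Σ_j w_{ij} · log(b_{ij}) ≥ Σ_i Σ_j w_{ij} · log(a_{ij}), then Σ_i log(Σ_j b_{ij}) ≥ Σ_i log(Σ_j a_{ij}). (This is the generalized-EM ascent step: whenever the M-step does not decrease the Q function, the observed-data log-likelihood of the finite mixture does not decrease.) -/

import Mathlib

/-- Generalized-EM ascent: if the M-step does not decrease the `Q` function
(with posterior weights `w i j = a (i,j) / ∑ k, a (i,k)`), then the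
observed-data log-likelihood of the finite mixture does not decrease. -/
theorem generalized_em_ascent {I J : Type*} [Fintype I] [Fintype J]
    [Nonempty I] [Nonempty J]
    (a b : I × J → ℝ) (ha : ∀ i j, 0 < a (i, j)) (hb : ∀ i j, 0 < b (i, j))
    (hQ : ∑ i, ∑ j, (a (i, j) / ∑ k, a (i, k)) * Real.log (b (i, j)) ≥
          ∑ i, ∑ j, (a (i, j) / ∑ k, a (i, k)) * Real.log (a (i, j))) :
    ∑ i, Real.log (∑ j, b (i, j)) ≥ ∑ i, Real.log (∑ j, a (i, j)) := by
  have key : ∀ i, ∑ j, (a (i, j) / ∑ k, a (i, k)) * Real.log (b (i, j)) -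
      ∑ j, (a (i, j) / ∑ k, a (i, k)) * Real.log (a (i, j)) ≤
      Real.log (∑ j, b (i, j)) - Real.log (∑ j, a (i, j)) := by
    intro i
    have hA : 0 < ∑ k, a (i, k) := Finset.sum_pos (fun j _ => ha i j) Finset.univ_nonempty
    have hB : 0 < ∑ k, b (i, k) := Finset.sum_pos (fun j _ => hb i j) Finset.univ_nonempty
    have hsA : ∑ j, a (i, j) / ∑ k, a (i, k) = 1 := by
      rw [← Finset.sum_div, div_self hA.ne']
    have hsB : ∑ j, b (i, j) / ∑ k, b (i, k) = 1 := by
      rw [← Finset.sum_div, div_self hB.ne']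
    generalize (∑ k, a (i, k)) = A at *
    generalize (∑ k, b (i, k)) = B at *
    rw [← Finset.sum_sub_distrib]
    calc _ ≤ ∑ j, ((a (i, j) / A) * (Real.log B - Real.log A) +
          (b (i, j) / B - a (i, j) / A)) := by
          apply Finset.sum_le_sum
          intro j _
          have h1 := ha i j
          have h2 := hb i j
          have h := Real.log_le_sub_one_of_pos
            (show 0 < (b (i, j) * A) / (a (i, j) * B) by positivity)
          rw [Real.log_div (by positivity) (by positivity), Real.log_mul h2.ne' hA.ne',
            Real.log_mul h1.ne' hB.ne'] at h
          have h3 := mul_le_mul_of_nonneg_left h (show 0 ≤ a (i, j) / A by positivity)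
          have h4 : a (i, j) / A * (b (i, j) * A / (a (i, j) * B) - 1) =
              b (i, j) / B - a (i, j) / A := by
            field_simp
          linarith
      _ = _ := by
          rw [Finset.sum_add_distrib, ← Finset.sum_mul, Finset.sum_sub_distrib, hsA, hsB]
          ring
  have h := Finset.sum_le_sum (fun i (_ : i ∈ Finset.univ) => key i)
  rw [Finset.sum_sub_distrib, Finset.sum_sub_distrib] at h
  linarith
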